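/- Let F ⊆ P²(F₄) be a four-point subset consisting of four collinear points. Then the group of permutations σ of the 21-point set P²(F₄) satisfying σ(C_F) = C_F has order 23040. -/

import Mathlib

/-- An `F`-rational line in the projective plane over `F`: the vanishing set of a nonzero
linear functional. -/
def IsProjLine (F : Type*) [Field F] (L : Set (Projectivization F (Fin 3 → F))) : Prop :=
  ∃ φ : (Fin 3 → F) →ₗ[F] F, φ ≠ 0 ∧ L = {P | φ P.rep = 0}

/-- A set of points of the projective plane is collinear if it is contained in a line. -/
def CollinSet (F : Type*) [Field F] (T : Set (Projectivization F (Fin 3 → F))) : Prop :=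
  ∃ L, IsProjLine F L ∧ T ⊆ L

/-- The Dolgachev–Kondō code `C_DK ⊆ Pow(P²(F₄))`: the `F₂`-linear span of the (indicator
functions of the) point sets of the `F₄`-rational lines. -/
noncomputable def CDK (F : Type*) [Field F] :
    Submodule (ZMod 2) (Projectivization F (Fin 3 → F) → ZMod 2) :=
  Submodule.span (ZMod 2)
    {w | ∃ L : Set (Projectivization F (Fin 3 → F)), IsProjLine F L ∧
      w = Set.indicator L (fun _ => (1 : ZMod 2))}

/-- The code `C_F = {w ∈ C_DK : |w ∩ F| even}`: the condition `|w ∩ F| ≡ 0 (mod 2)` is the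
vanishing of the `F₂`-linear functional `w ↦ ∑_{x ∈ F} w(x)`. -/
noncomputable def CF (F : Type*) [Field F] (Fs : Finset (Projectivization F (Fin 3 → F))) :
    Submodule (ZMod 2) (Projectivization F (Fin 3 → F) → ZMod 2) :=
  CDK F ⊓ LinearMap.ker (∑ x ∈ Fs, LinearMap.proj x)

/-! ### The code on 21 labelled points

The points are labelled so that `4 * i + j` (with `i < 5`, `j < 4`) runs over the affine part of the
`i`-th line through the point `20`. -/

namespace TetradCode

open Equiv

/-- Columns of the systematic generator matrix of the code, read as binary numbers. -/
def col : Fin 21 → ℕ :=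
  ![1, 2, 4, 7, 8, 16, 32, 56, 64, 91, 109, 118, 256, 307, 285, 302, 457, 482, 508, 471, 128]

/-- An information set: the column at `infoPt k` is the `k`-th unit vector. -/
def infoPt : Fin 9 → Fin 21 := ![0, 1, 2, 4, 5, 6, 8, 20, 12]

/-- Membership in the code, in terms of the coordinates at the information set. -/
def InCode (w : Fin 21 → ZMod 2) : Prop :=
  ∀ x, w x = ∑ k : Fin 9, if (col x).testBit k then w (infoPt k) else 0

/-- The permutations that preserve the code. -/
def autGroup : Subgroup (Perm (Fin 21)) where
  carrier := {σ | ∀ w, InCode (w ∘ σ) ↔ InCode w}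
  mul_mem' {σ τ} hσ hτ w := by
    rw [Perm.coe_mul, ← Function.comp_assoc, hτ, hσ]
  one_mem' w := Iff.rfl
  inv_mem' {σ} hσ w := by
    rw [← hσ, Function.comp_assoc]
    simp

/-- The sum, in binary without carry, of the numbers `g k` over the set bits `k` of `m`. -/
def mix (g : Fin 9 → ℕ) (m : ℕ) : ℕ :=
  (List.finRange 9).foldr (fun (k : Fin 9) acc => (if m.testBit k then g k else 0) ^^^ acc) 0

/-- A bit as an element of `ZMod 2`. -/
def bitVal (b : Bool) : ZMod 2 := if b then 1 else 0

theorem bitVal_xor : ∀ a b : Bool, bitVal (a ^^ b) = bitVal a + bitVal b := by decide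

theorem bitVal_injective : Function.Injective bitVal := by decide

theorem bitVal_testBit_mix (g : Fin 9 → ℕ) (m j : ℕ) :
    bitVal ((mix g m).testBit j) =
      ∑ k : Fin 9, if m.testBit k then bitVal ((g k).testBit j) else 0 := by
  rw [Fin.sum_univ_def, mix]
  induction List.finRange 9 with
  | nil => simp [bitVal]
  | cons k l ih =>
    rw [List.foldr_cons, Nat.testBit_xor, bitVal_xor, ih, List.map_cons, List.sum_cons]
    split_ifs <;> simp [bitVal]

theorem mix_lt (g : Fin 9 → ℕ) (hg : ∀ k, g k < 2 ^ 9) (m : ℕ) : mix g m < 2 ^ 9 := by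
  rw [mix]
  induction List.finRange 9 with
  | nil => simp
  | cons k l ih =>
    refine Nat.xor_lt_two_pow ?_ ih
    split_ifs
    exacts [hg k, by norm_num]

theorem col_lt : ∀ x, col x < 2 ^ 9 := by decide

theorem col_injective : Function.Injective col := by decide +kernel

theorem mix_col_infoPt : ∀ x, mix (col ∘ infoPt) (col x) = col x := by decide +kernel

theorem inCode_row (j : Fin 9) : InCode fun x => bitVal ((col x).testBit j) := by
  intro x
  beta_reduce
  conv_lhs => rw [← mix_col_infoPt x, bitVal_testBit_mix]
  rfl

theorem inCode_comp {f : Fin 21 → Fin 21}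
    (hf : ∀ x, col (f x) = mix (col ∘ f ∘ infoPt) (col x)) {w : Fin 21 → ZMod 2}
    (hw : InCode w) : InCode (w ∘ f) := by
  have key (x : Fin 21) :
      w x = ∑ j : Fin 9, bitVal ((col x).testBit j) * w (infoPt j) := by
    rw [hw x]
    simp [bitVal]
  intro x
  simp only [Function.comp_apply]
  rw [key (f x), hf x]
  simp only [bitVal_testBit_mix, Finset.sum_mul]
  rw [Finset.sum_comm]
  refine Finset.sum_congr rfl fun k _ => ?_
  split_ifs
  · rw [key (f (infoPt k))]
    rfl
  · simp

theorem mem_autGroup {σ : Perm (Fin 21)} :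
    σ ∈ autGroup ↔ ∀ x, col (σ x) = mix (col ∘ σ ∘ infoPt) (col x) := by
  constructor
  · intro hσ x
    refine Nat.eq_of_testBit_eq fun j => ?_
    by_cases hj : j < 9
    · apply bitVal_injective
      rw [bitVal_testBit_mix]
      exact (hσ _).2 (inCode_row ⟨j, hj⟩) x
    · have h9 : 2 ^ 9 ≤ 2 ^ j := Nat.pow_le_pow_right (by norm_num) (not_lt.1 hj)
      exact (Nat.testBit_lt_two_pow ((col_lt _).trans_le h9)).trans
        (Nat.testBit_lt_two_pow ((mix_lt _ (fun k => col_lt (σ (infoPt k))) _).trans_le h9)).symm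
  · intro hσ
    have pow_mem (n : ℕ) (w : Fin 21 → ZMod 2) (hw : InCode w) : InCode (w ∘ ⇑(σ ^ n)) := by
      induction n with
      | zero => exact hw
      | succ n ih =>
        rw [pow_succ, Perm.coe_mul, ← Function.comp_assoc]
        exact inCode_comp hσ ih
    refine fun w => ⟨fun hw => ?_, inCode_comp hσ⟩
    have h := pow_mem (orderOf σ - 1) _ hw
    rwa [Function.comp_assoc, ← Perm.coe_mul, mul_pow_sub_one (orderOf_pos σ).ne',
      pow_orderOf_eq_one, Perm.coe_one, Function.comp_id] at h

/-- The index of the line through `20` on which the point lies. -/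
def block (x : Fin 21) : ℕ := x / 4

/-- The set of columns, read as a binary number. -/
def colMask : ℕ := (List.ofFn col).foldr (fun m s => 2 ^ m ||| s) 0

theorem testBit_colMask : ∀ x, colMask.testBit (col x) = true := by decide +kernel

theorem testBit_colMask_eq_false : ∀ a b, block a ≠ block b → ∀ c, c ≠ a → c ≠ b →
    colMask.testBit (col a ^^^ col b ^^^ col c) = false := by
  decide +kernel

theorem block_eq_of_xor_eq_zero {a b c d : Fin 21} (hca : c ≠ a) (hcb : c ≠ b)
    (h : col a ^^^ col b ^^^ col c ^^^ col d = 0) : block a = block b := by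
  by_contra hab
  have h1 := testBit_colMask_eq_false a b hab c hca hcb
  rw [Nat.xor_eq_zero_iff.1 h, testBit_colMask] at h1
  exact absurd h1 (by decide)

theorem exists_xor_eq_zero : ∀ a b, a ≠ b → block a = block b →
    ∃ c d, c ≠ a ∧ c ≠ b ∧ col a ^^^ col b ^^^ col c ^^^ col d = 0 := by
  decide +kernel

theorem mix_xor (g : Fin 9 → ℕ) (m n : ℕ) : mix g (m ^^^ n) = mix g m ^^^ mix g n := by
  simp only [mix]
  induction List.finRange 9 with
  | nil => simp
  | cons k l ih =>
    simp only [List.foldr_cons, ih]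
    rw [Nat.testBit_xor]
    cases m.testBit k <;> cases n.testBit k <;>
      simp [Nat.xor_left_comm, Nat.xor_assoc]

theorem block_apply_eq {σ : Perm (Fin 21)} (hσ : σ ∈ autGroup) {x y : Fin 21}
    (hxy : block x = block y) : block (σ x) = block (σ y) := by
  rcases eq_or_ne x y with rfl | hne
  · rfl
  obtain ⟨c, d, hcx, hcy, h⟩ := exists_xor_eq_zero x y hne hxy
  refine block_eq_of_xor_eq_zero (d := σ d) (σ.injective.ne hcx) (σ.injective.ne hcy) ?_
  rw [mem_autGroup] at hσ
  rw [hσ x, hσ y, hσ c, hσ d, ← mix_xor, ← mix_xor, ← mix_xor, h]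
  simp [mix]

theorem block_apply_eq_iff {σ : Perm (Fin 21)} (hσ : σ ∈ autGroup) {x y : Fin 21} :
    block (σ x) = block (σ y) ↔ block x = block y :=
  ⟨fun h => by simpa using block_apply_eq (inv_mem hσ) h, block_apply_eq hσ⟩

theorem apply_twenty {σ : Perm (Fin 21)} (hσ : σ ∈ autGroup) : σ 20 = 20 := by
  have h1 : ∀ x : Fin 21, (∀ y, block y = block x → y = x) → x = 20 := by decide
  have h2 : ∀ y : Fin 21, block y = block 20 → y = 20 := by decide
  refine h1 _ fun y hy => ?_
  obtain ⟨z, rfl⟩ := σ.surjective y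
  rw [h2 z ((block_apply_eq_iff hσ).1 hy)]

/-- The automorphisms that fix every point of a list. -/
def fixing (l : List (Fin 21)) : Subgroup (Perm (Fin 21)) where
  carrier := {σ | σ ∈ autGroup ∧ ∀ x ∈ l, σ x = x}
  mul_mem' {σ τ} hσ hτ := ⟨mul_mem hσ.1 hτ.1, fun x hx => by
    rw [Perm.mul_apply, hτ.2 x hx, hσ.2 x hx]⟩
  one_mem' := ⟨one_mem _, fun _ _ => rfl⟩
  inv_mem' {σ} hσ := ⟨inv_mem hσ.1, fun x hx => by
    rw [Perm.inv_eq_iff_eq, hσ.2 x hx]⟩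

theorem mem_fixing {l : List (Fin 21)} {σ : Perm (Fin 21)} :
    σ ∈ fixing l ↔ σ ∈ autGroup ∧ ∀ x ∈ l, σ x = x := Iff.rfl

theorem card_fixing (l : List (Fin 21)) (b : Fin 21) (s : Finset (Fin 21))
    (hs : ∀ x, (∃ σ ∈ fixing l, σ b = x) ↔ x ∈ s) :
    Nat.card (fixing l) = s.card * Nat.card (fixing (b :: l)) := by
  have horb : MulAction.orbit (fixing l) b = s := by
    ext x
    rw [Finset.mem_coe, ← hs]
    exact ⟨fun ⟨σ, h⟩ => ⟨σ, σ.2, h⟩, fun ⟨σ, hσ, h⟩ => ⟨⟨σ, hσ⟩, h⟩⟩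
  have hstab : Nat.card (MulAction.stabilizer (fixing l) b) = Nat.card (fixing (b :: l)) := by
    refine Nat.card_congr ⟨fun σ => ⟨σ, ?_⟩, fun σ => ⟨⟨σ, ?_⟩, ?_⟩, fun _ => rfl, fun _ => rfl⟩
    · exact ⟨σ.1.2.1, List.forall_mem_cons.2 ⟨σ.2, σ.1.2.2⟩⟩
    · exact ⟨σ.2.1, (List.forall_mem_cons.1 σ.2.2).2⟩
    · exact (List.forall_mem_cons.1 σ.2.2).1
  rw [← Nat.card_congr (MulAction.orbitProdStabilizerEquivGroup (fixing l) b), Nat.card_prod,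
    hstab, horb, Nat.card_coe_set_eq, Set.ncard_coe_finset]

/-- A self-map of the points that is an automorphism of the code and fixes a list of points. -/
def IsSymm (l : List (Fin 21)) (f : Fin 21 → Fin 21) : Prop :=
  Function.Injective f ∧ (∀ x, col (f x) = mix (col ∘ f ∘ infoPt) (col x)) ∧ ∀ x ∈ l, f x = x

instance (l : List (Fin 21)) (f : Fin 21 → Fin 21) : Decidable (IsSymm l f) :=
  inferInstanceAs (Decidable (_ ∧ _ ∧ _))

theorem IsSymm.exists_perm {l : List (Fin 21)} {f : Fin 21 → Fin 21} (hf : IsSymm l f) :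
    ∃ σ ∈ fixing l, ⇑σ = f := by
  refine ⟨Equiv.ofBijective f (Finite.injective_iff_bijective.1 hf.1), ⟨?_, hf.2.2⟩, rfl⟩
  exact mem_autGroup.2 hf.2.1

theorem exists_mem_fixing {l : List (Fin 21)} {f g : Fin 21 → Fin 21} (hf : IsSymm l f)
    (hg : IsSymm l g) {b x : Fin 21} (h : ∃ i < 10, ∃ j < 4, f^[i] (g^[j] b) = x) :
    ∃ σ ∈ fixing l, σ b = x := by
  obtain ⟨i, -, j, -, rfl⟩ := h
  obtain ⟨σ, hσ, rfl⟩ := hf.exists_perm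
  obtain ⟨τ, hτ, rfl⟩ := hg.exists_perm
  exact ⟨σ ^ i * τ ^ j, mul_mem (pow_mem hσ i) (pow_mem hτ j), by
    simp [Perm.mul_apply, Perm.iterate_eq_pow]⟩

theorem card_fixing_nil : Nat.card (fixing []) = 20 * Nat.card (fixing [0]) := by
  refine card_fixing [] 0 (Finset.univ.erase 20) fun x => ⟨?_, fun hx => ?_⟩
  · rintro ⟨σ, hσ, rfl⟩
    simp only [Finset.mem_erase, Finset.mem_univ, and_true]
    rw [← apply_twenty hσ.1, σ.injective.ne_iff]
    decide
  · refine exists_mem_fixing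
      (f := ![8, 10, 11, 9, 15, 13, 12, 14, 7, 4, 6, 5, 19, 16, 18, 17, 0, 1, 2, 3, 20])
      (g := ![3, 2, 1, 0, 4, 5, 6, 7, 8, 9, 10, 11, 13, 12, 15, 14, 18, 19, 16, 17, 20])
      (by decide +kernel) (by decide +kernel) ?_
    revert x
    decide +kernel

theorem card_fixing_zero : Nat.card (fixing [0]) = 3 * Nat.card (fixing [1, 0]) := by
  refine card_fixing [0] 1 {1, 2, 3} fun x => ⟨?_, fun hx => ?_⟩
  · rintro ⟨σ, hσ, rfl⟩
    have h0 : σ 0 = 0 := hσ.2 0 (by decide)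
    have h1 : block (σ 1) = block 0 := by rw [← h0, block_apply_eq_iff hσ.1]; decide
    have h2 : σ 1 ≠ 0 := by rw [← h0, σ.injective.ne_iff]; decide
    generalize σ 1 = y at h1 h2
    decide +revert
  · refine exists_mem_fixing
      (f := ![0, 2, 3, 1, 7, 5, 4, 6, 9, 11, 10, 8, 12, 14, 15, 13, 17, 19, 18, 16, 20])
      (g := id) (by decide +kernel) (by decide +kernel) ?_
    revert x
    decide +kernel

theorem card_fixing_one : Nat.card (fixing [1, 0]) = 2 * Nat.card (fixing [2, 1, 0]) := by
  refine card_fixing [1, 0] 2 {2, 3} fun x => ⟨?_, fun hx => ?_⟩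
  · rintro ⟨σ, hσ, rfl⟩
    have h0 : σ 0 = 0 := hσ.2 0 (by decide)
    have h1 : σ 1 = 1 := hσ.2 1 (by decide)
    have h2 : block (σ 2) = block 0 := by rw [← h0, block_apply_eq_iff hσ.1]; decide
    have h3 : σ 2 ≠ 0 := by rw [← h0, σ.injective.ne_iff]; decide
    have h4 : σ 2 ≠ 1 := by rw [← h1, σ.injective.ne_iff]; decide
    generalize σ 2 = y at h2 h3 h4
    decide +revert
  · refine exists_mem_fixing
      (f := ![0, 1, 3, 2, 4, 5, 7, 6, 9, 8, 10, 11, 18, 19, 17, 16, 15, 14, 12, 13, 20])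
      (g := id) (by decide +kernel) (by decide +kernel) ?_
    revert x
    decide +kernel

theorem card_fixing_two : Nat.card (fixing [2, 1, 0]) = 16 * Nat.card (fixing [4, 2, 1, 0]) := by
  refine card_fixing [2, 1, 0] 4 (Finset.Ico 4 20) fun x => ⟨?_, fun hx => ?_⟩
  · rintro ⟨σ, hσ, rfl⟩
    have h0 : σ 0 = 0 := hσ.2 0 (by decide)
    have h1 : block (σ 4) ≠ block 0 := by rw [← h0, Ne, block_apply_eq_iff hσ.1]; decide
    have h2 : σ 4 ≠ 20 := by rw [← apply_twenty hσ.1, σ.injective.ne_iff]; decide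
    generalize σ 4 = y at h1 h2
    decide +revert
  · refine exists_mem_fixing
      (f := ![0, 1, 2, 3, 17, 18, 16, 19, 14, 12, 13, 15, 11, 8, 10, 9, 4, 6, 7, 5, 20])
      (g := ![0, 1, 2, 3, 14, 12, 13, 15, 17, 18, 16, 19, 4, 7, 5, 6, 11, 9, 8, 10, 20])
      (by decide +kernel) (by decide +kernel) ?_
    revert x
    decide +kernel

theorem card_fixing_four :
    Nat.card (fixing [4, 2, 1, 0]) = 3 * Nat.card (fixing [5, 4, 2, 1, 0]) := by
  refine card_fixing [4, 2, 1, 0] 5 {5, 6, 7} fun x => ⟨?_, fun hx => ?_⟩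
  · rintro ⟨σ, hσ, rfl⟩
    have h0 : σ 4 = 4 := hσ.2 4 (by decide)
    have h1 : block (σ 5) = block 4 := by rw [← h0, block_apply_eq_iff hσ.1]; decide
    have h2 : σ 5 ≠ 4 := by rw [← h0, σ.injective.ne_iff]; decide
    generalize σ 5 = y at h1 h2
    decide +revert
  · refine exists_mem_fixing
      (f := ![0, 1, 2, 3, 4, 7, 5, 6, 12, 13, 14, 15, 16, 17, 18, 19, 8, 9, 10, 11, 20])
      (g := id) (by decide +kernel) (by decide +kernel) ?_
    revert x
    decide +kernel

/-- Once five points are fixed, the images of the remaining points of the information set are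
almost determined. -/
theorem rigidity : ∀ a, block a = 1 → a ≠ 4 → a ≠ 5 → ∀ b c : Fin 21,
    (∀ x, colMask.testBit (mix (col ∘ ![0, 1, 2, 4, 5, a, b, 20, c]) (col x)) = true) →
      a = 6 ∧ block b = 2 ∧ (b = 8 → c = 12) := by
  decide +kernel

theorem apply_of_mem_fixing_five {σ : Perm (Fin 21)} (hσ : σ ∈ fixing [5, 4, 2, 1, 0]) :
    σ 6 = 6 ∧ block (σ 8) = 2 ∧ (σ 8 = 8 → σ 12 = 12) := by
  have hfix := hσ.2
  simp only [List.forall_mem_cons] at hfix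
  obtain ⟨h5, h4, h2, h1, h0, -⟩ := hfix
  refine rigidity (σ 6) ?_ ?_ ?_ (σ 8) (σ 12) fun x => ?_
  · have : block (σ 6) = block (σ 4) := by rw [block_apply_eq_iff hσ.1]; decide
    rw [this, h4]
    decide
  · exact fun h => absurd (σ.injective (h.trans h4.symm)) (by decide)
  · exact fun h => absurd (σ.injective (h.trans h5.symm)) (by decide)
  · have himg : σ ∘ infoPt = ![0, 1, 2, 4, 5, σ 6, σ 8, 20, σ 12] := by
      funext k
      fin_cases k
      exacts [h0, h1, h2, h4, h5, rfl, rfl, apply_twenty hσ.1, rfl]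
    rw [← himg, ← mem_autGroup.1 hσ.1 x, testBit_colMask]

theorem card_fixing_five :
    Nat.card (fixing [5, 4, 2, 1, 0]) = 4 * Nat.card (fixing [8, 5, 4, 2, 1, 0]) := by
  refine card_fixing [5, 4, 2, 1, 0] 8 {8, 9, 10, 11} fun x => ⟨?_, fun hx => ?_⟩
  · rintro ⟨σ, hσ, rfl⟩
    have h := (apply_of_mem_fixing_five hσ).2.1
    generalize σ 8 = y at h
    decide +revert
  · refine exists_mem_fixing
      (f := ![0, 1, 2, 3, 4, 5, 6, 7, 10, 11, 8, 9, 13, 12, 15, 14, 19, 18, 17, 16, 20])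
      (g := ![0, 1, 2, 3, 4, 5, 6, 7, 11, 10, 9, 8, 14, 15, 12, 13, 17, 16, 19, 18, 20])
      (by decide +kernel) (by decide +kernel) ?_
    revert x
    decide +kernel

theorem fixing_eight : fixing [8, 5, 4, 2, 1, 0] = ⊥ := by
  refine (Subgroup.eq_bot_iff_forall _).2 fun σ hσ => ?_
  have hfix := hσ.2
  simp only [List.forall_mem_cons] at hfix
  obtain ⟨h8, h5, h4, h2, h1, h0, -⟩ := hfix
  obtain ⟨h6, -, h12⟩ := apply_of_mem_fixing_five (σ := σ)
    ⟨hσ.1, (List.forall_mem_cons.1 hσ.2).2⟩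
  have himg : σ ∘ infoPt = infoPt := by
    funext k
    fin_cases k
    exacts [h0, h1, h2, h4, h5, h6, h8, apply_twenty hσ.1, h12 h8]
  ext1 x
  apply col_injective
  rw [mem_autGroup.1 hσ.1 x, himg, mix_col_infoPt]
  rfl

theorem card_autGroup : Nat.card autGroup = 23040 := by
  have h : fixing [] = autGroup := by
    ext σ
    simp [mem_fixing]
  rw [← h, card_fixing_nil, card_fixing_zero, card_fixing_one, card_fixing_two, card_fixing_four,
    card_fixing_five, fixing_eight, Subgroup.card_bot]

/-! ### Coordinates on the projective plane over a field with four elements -/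

open Module

/-- Addition of the field with four elements, with `2` and `3` in the role of the two elements
outside the prime field. -/
def add4 (a b : Fin 4) : Fin 4 := ![![0, 1, 2, 3], ![1, 0, 3, 2], ![2, 3, 0, 1], ![3, 2, 1, 0]] a b

/-- Multiplication of the field with four elements. -/
def mul4 (a b : Fin 4) : Fin 4 := ![![0, 0, 0, 0], ![0, 1, 2, 3], ![0, 2, 3, 1], ![0, 3, 1, 2]] a b

/-- The elements of a field with four elements, in terms of an element outside the prime field. -/
def elt {F : Type*} [Field F] (ω : F) : Fin 4 → F := ![0, 1, ω, ω + 1]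

section FieldWithFourElements

variable {F : Type*} [Field F]

theorem exists_generator [Fintype F] (hF : Fintype.card F = 4) :
    (2 : F) = 0 ∧ ∃ ω : F, ω ≠ 0 ∧ ω ≠ 1 ∧ ω ^ 2 = ω + 1 := by
  classical
  have h4 : (4 : F) = 0 := by
    have := Nat.cast_card_eq_zero F
    rw [hF] at this
    exact_mod_cast this
  have h2 : (2 : F) = 0 := by
    have : (2 : F) * 2 = 0 := by rw [← h4]; norm_num
    simpa using this
  obtain ⟨ω, hω⟩ : ∃ ω : F, ω ∉ ({0, 1} : Finset F) := by
    by_contra! h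
    have := Finset.card_le_card (fun x _ => h x : (Finset.univ : Finset F) ⊆ {0, 1})
    rw [Finset.card_univ, hF] at this
    exact absurd (this.trans Finset.card_le_two) (by norm_num)
  simp only [Finset.mem_insert, Finset.mem_singleton, not_or] at hω
  refine ⟨h2, ω, hω.1, hω.2, ?_⟩
  have h3 : ω ^ 3 = 1 := by
    have := FiniteField.pow_card_sub_one_eq_one ω hω.1
    rwa [hF] at this
  refine mul_left_cancel₀ (sub_ne_zero.2 hω.2) ?_
  linear_combination h3 + (1 - ω ^ 2) * h2

theorem elt_add {ω : F} (h2 : (2 : F) = 0) (a b : Fin 4) : elt ω (add4 a b) = elt ω a + elt ω b := by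
  fin_cases a <;> fin_cases b <;> simp [elt, add4] <;> grind

theorem elt_mul {ω : F} (h2 : (2 : F) = 0) (hω : ω ^ 2 = ω + 1) (a b : Fin 4) :
    elt ω (mul4 a b) = elt ω a * elt ω b := by
  fin_cases a <;> fin_cases b <;> simp [elt, mul4] <;> grind

theorem elt_bijective {ω : F} (h2 : (2 : F) = 0) [Fintype F] (hF : Fintype.card F = 4)
    (h0 : ω ≠ 0) (h1 : ω ≠ 1) :
    Function.Bijective (elt ω) := by
  rw [Fintype.bijective_iff_injective_and_card, hF, Fintype.card_fin]
  refine ⟨fun a b h => ?_, rfl⟩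
  fin_cases a <;> fin_cases b <;> simp [elt] at h ⊢ <;> grind

end FieldWithFourElements

/-- Homogeneous coordinates of the labelled points. -/
def coords (x : Fin 21) : Fin 3 → Fin 4 :=
  ![![1, 0, 1, 1, 1, 0] ⟨x / 4, by omega⟩, ![0, 1, 1, 2, 3, 0] ⟨x / 4, by omega⟩,
    if x = 20 then 1 else ⟨x % 4, by omega⟩]

/-- The value at a point of the linear form with coefficients `a`, `b`, `c`. -/
def form (a b c : Fin 4) (x : Fin 21) : Fin 4 :=
  add4 (add4 (mul4 (coords x 0) a) (mul4 (coords x 1) b)) (mul4 (coords x 2) c)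

/-- The indicator function of a line. -/
def lineWord (l : Fin 4 × Fin 4 × Fin 4) (x : Fin 21) : ZMod 2 :=
  if form l.1 l.2.1 l.2.2 x = 0 then 1 else 0

/-- Lines whose words add up to the rows of the systematic generator matrix. -/
def rowLines : Fin 9 → List (Fin 4 × Fin 4 × Fin 4) :=
  ![[(0, 1, 1), (1, 2, 2)], [(1, 0, 1), (1, 0, 2)], [(1, 0, 2), (1, 0, 3)],
    [(1, 0, 3), (1, 2, 3)], [(0, 1, 1), (0, 1, 2)], [(0, 1, 2), (0, 1, 3)],
    [(1, 1, 0), (1, 2, 0)], [(1, 2, 0)], [(1, 2, 0), (1, 3, 0)]]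

theorem rowLines_ne_zero : ∀ k, ∀ l ∈ rowLines k, l ≠ 0 := by decide

theorem sum_rowLines : ∀ k x,
    ((rowLines k).map fun l => lineWord l x).sum = bitVal ((col x).testBit k) := by
  decide +kernel

theorem sum_row_tetrad : ∀ k : Fin 9,
    ∑ x ∈ ({0, 1, 2, 3} : Finset (Fin 21)), bitVal ((col x).testBit k) = 0 := by
  decide +kernel

theorem inCode_lineWord_add : ∀ a b c : Fin 4, (a, b, c) ≠ 0 → ∀ x,
    lineWord (a, b, c) x + (∑ y ∈ ({0, 1, 2, 3} : Finset (Fin 21)), lineWord (a, b, c) y) *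
      lineWord (0, 0, 1) x = ∑ k : Fin 9, if (col x).testBit k then
        lineWord (a, b, c) (infoPt k) +
          (∑ y ∈ ({0, 1, 2, 3} : Finset (Fin 21)), lineWord (a, b, c) y) *
            lineWord (0, 0, 1) (infoPt k) else 0 := by
  decide +kernel

theorem eq_of_coords_eq_mul : ∀ x y a, (∀ i, coords x i = mul4 a (coords y i)) → x = y := by
  decide +kernel

theorem coords_ne_zero : ∀ x, ∃ i, coords x i ≠ 0 := by
  decide +kernel

section Coordinates

variable {F : Type*} [Field F]

local notation "V" => Fin 3 → F
local notation "ℙ²" => Projectivization F (Fin 3 → F)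

theorem exists_basis {φ : V →ₗ[F] F} (hφ : φ ≠ 0) {p : V} (hp : p ≠ 0) (hφp : φ p = 0) :
    ∃ b : Basis (Fin 3) F V, b 2 = p ∧ φ (b 0) = 0 ∧ φ (b 1) ≠ 0 := by
  obtain ⟨v, hv⟩ : ∃ v, φ v ≠ 0 := by
    by_contra! h
    exact hφ (LinearMap.ext h)
  obtain ⟨u, hu, hup⟩ : ∃ u ∈ LinearMap.ker φ, u ∉ Submodule.span F {p} := by
    by_contra! h
    have h1 := Submodule.finrank_mono (show LinearMap.ker φ ≤ Submodule.span F {p} from h)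
    have h2 := φ.finrank_range_add_finrank_ker
    have h3 := Submodule.finrank_le (LinearMap.range φ)
    rw [finrank_span_singleton hp] at h1
    simp only [finrank_fin_fun, finrank_self] at h2 h3
    omega
  rw [LinearMap.mem_ker] at hu
  have hli : LinearIndependent F ![u, v, p] := by
    rw [Fintype.linearIndependent_iff]
    intro g hg
    simp only [Fin.sum_univ_three, Matrix.cons_val] at hg
    have h1 : g 1 = 0 := by
      have := congrArg φ hg
      simpa [hu, hφp, hv] using this
    have h0 : g 0 = 0 := by
      by_contra h0
      refine hup (Submodule.mem_span_singleton.2 ⟨-(g 0)⁻¹ * g 2, ?_⟩)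
      rw [h1, zero_smul, add_zero] at hg
      rw [mul_smul, ← sub_eq_zero, eq_neg_of_add_eq_zero_right hg, neg_smul, smul_neg, neg_neg,
        inv_smul_smul₀ h0, sub_self]
    have h2 : g 2 = 0 := by simpa [h0, h1, hp] using hg
    intro i
    fin_cases i
    exacts [h0, h1, h2]
  refine ⟨basisOfLinearIndependentOfCardEqFinrank hli (by simp), ?_, ?_, ?_⟩ <;>
    simp [hu, hv]

/-- The vector with given coordinates in a basis. -/
noncomputable def pointVec (ω : F) (b : Basis (Fin 3) F V) (x : Fin 21) : V :=
  ∑ i, elt ω (coords x i) • b i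

theorem repr_pointVec (ω : F) (b : Basis (Fin 3) F V) (x : Fin 21) (i : Fin 3) :
    b.repr (pointVec ω b x) i = elt ω (coords x i) := by
  rw [pointVec, b.repr_sum_self]

theorem exists_equiv [Fintype F] (hF : Fintype.card F = 4) {ω : F} (h2 : (2 : F) = 0)
    (h0 : ω ≠ 0) (h1 : ω ≠ 1) (hω : ω ^ 2 = ω + 1) (b : Basis (Fin 3) F V) :
    ∃ (h : ∀ x, pointVec ω b x ≠ 0) (e : Fin 21 ≃ ℙ²),
      ∀ x, e x = Projectivization.mk F (pointVec ω b x) (h x) := by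
  have hbij := elt_bijective h2 hF h0 h1
  have hne (x : Fin 21) : pointVec ω b x ≠ 0 := fun h => by
    obtain ⟨i, hi⟩ := coords_ne_zero x
    refine hi (hbij.1 ?_)
    rw [← repr_pointVec ω b, h, map_zero, Finsupp.zero_apply]
    rfl
  have hinj : Function.Injective fun x => Projectivization.mk F (pointVec ω b x) (hne x) := by
    intro x y hxy
    obtain ⟨a, ha⟩ := (Projectivization.mk_eq_mk_iff' F _ _ (hne x) (hne y)).1 hxy
    obtain ⟨a, rfl⟩ := hbij.2 a
    refine eq_of_coords_eq_mul x y a fun i => hbij.1 ?_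
    rw [elt_mul h2 hω, ← repr_pointVec ω b, ← repr_pointVec ω b, ← ha, map_smul,
      Finsupp.smul_apply, smul_eq_mul]
  have hcard : Nat.card ℙ² = 21 := by
    rw [Projectivization.card_of_finrank F V (finrank_fin_fun F), Nat.card_eq_fintype_card, hF]
    rfl
  have hfin : Finite ℙ² := Nat.finite_of_card_ne_zero (by omega)
  refine ⟨hne, Equiv.ofBijective _ ((Nat.bijective_iff_injective_and_card _).2 ⟨hinj, ?_⟩),
    fun x => rfl⟩
  rw [hcard, Nat.card_eq_fintype_card, Fintype.card_fin]

theorem apply_rep_eq_zero_iff (φ : V →ₗ[F] F) {v : V} (hv : v ≠ 0) :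
    φ (Projectivization.mk F v hv).rep = 0 ↔ φ v = 0 := by
  obtain ⟨a, ha⟩ := Projectivization.exists_smul_eq_mk_rep F v hv
  rw [← ha, Units.smul_def, map_smul, smul_eq_zero, or_iff_right a.ne_zero]

theorem apply_pointVec {ω : F} (h2 : (2 : F) = 0) (hω : ω ^ 2 = ω + 1) (b : Basis (Fin 3) F V)
    (φ : V →ₗ[F] F) {l : Fin 4 × Fin 4 × Fin 4} (hl0 : φ (b 0) = elt ω l.1)
    (hl1 : φ (b 1) = elt ω l.2.1) (hl2 : φ (b 2) = elt ω l.2.2) (x : Fin 21) :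
    φ (pointVec ω b x) = elt ω (form l.1 l.2.1 l.2.2 x) := by
  rw [pointVec, map_sum, Fin.sum_univ_three, map_smul, map_smul, map_smul, hl0, hl1, hl2, form]
  simp only [elt_add h2, elt_mul h2 hω, smul_eq_mul]

/-- A labelling of the points under which the lines are the zero sets of the coordinate forms and
`T` is the first tetrad. -/
structure IsLabelling (e : Fin 21 ≃ ℙ²) (T : Finset ℙ²) : Prop where
  exists_form : ∀ L, IsProjLine F L →
    ∃ l : Fin 4 × Fin 4 × Fin 4, l ≠ 0 ∧ ∀ x, e x ∈ L ↔ form l.1 l.2.1 l.2.2 x = 0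
  exists_line : ∀ l : Fin 4 × Fin 4 × Fin 4, l ≠ 0 →
    ∃ L, IsProjLine F L ∧ ∀ x, e x ∈ L ↔ form l.1 l.2.1 l.2.2 x = 0
  eq_map : T = ({0, 1, 2, 3} : Finset (Fin 21)).map e.toEmbedding

theorem coords_one_eq_zero_iff : ∀ x, coords x 1 = 0 ↔ x ∈ ({0, 1, 2, 3, 20} : Finset (Fin 21)) := by
  decide +kernel

theorem exists_isLabelling [Fintype F] (hF : Fintype.card F = 4) {T : Finset ℙ²}
    (hcard : T.card = 4) (hT : CollinSet F (T : Set ℙ²)) :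
    ∃ e : Fin 21 ≃ ℙ², IsLabelling e T := by
  obtain ⟨h2, ω, h0, h1, hω⟩ := exists_generator hF
  have hbij := elt_bijective h2 hF h0 h1
  obtain ⟨_, ⟨φ, hφ, rfl⟩, hT⟩ := hT
  have elt_zero : elt ω 0 = 0 := rfl
  have hline (b : Basis (Fin 3) F V) (hb0 : φ (b 0) = 0) (hb1 : φ (b 1) ≠ 0) (hb2 : φ (b 2) = 0)
      (x : Fin 21) : φ (pointVec ω b x) = 0 ↔ x ∈ ({0, 1, 2, 3, 20} : Finset (Fin 21)) := by
    rw [← coords_one_eq_zero_iff, ← hbij.1.eq_iff, elt_zero]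
    simp [pointVec, Fin.sum_univ_three, hb0, hb1, hb2]
  obtain ⟨P, hP, hPT⟩ : ∃ P : ℙ², φ P.rep = 0 ∧ P ∉ T := by
    obtain ⟨q, hq, hq0⟩ := (LinearMap.ker φ).exists_mem_ne_zero_of_ne_bot <|
      LinearMap.ker_ne_bot_of_finrank_lt (by simp)
    obtain ⟨b, hb2, hb0, hb1⟩ := exists_basis hφ hq0 hq
    obtain ⟨hne, e, he⟩ := exists_equiv hF h2 h0 h1 hω b
    obtain ⟨P, hP, hPT⟩ := Finset.exists_mem_notMem_of_card_lt_card
      (s := T) (t := ({0, 1, 2, 3, 20} : Finset (Fin 21)).map e.toEmbedding)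
      (by rw [hcard, Finset.card_map]; decide)
    obtain ⟨x, hx, rfl⟩ := Finset.mem_map.1 hP
    refine ⟨e x, ?_, hPT⟩
    rw [he, apply_rep_eq_zero_iff, hline b hb0 hb1 (hb2 ▸ hq)]
    exact hx
  obtain ⟨b, hb2, hb0, hb1⟩ := exists_basis hφ P.rep_nonzero hP
  obtain ⟨hne, e, he⟩ := exists_equiv hF h2 h0 h1 hω b
  have mem_iff (ψ : V →ₗ[F] F) {l : Fin 4 × Fin 4 × Fin 4} (hl0 : ψ (b 0) = elt ω l.1)
      (hl1 : ψ (b 1) = elt ω l.2.1) (hl2 : ψ (b 2) = elt ω l.2.2) (x : Fin 21) :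
      e x ∈ {Q : ℙ² | ψ Q.rep = 0} ↔ form l.1 l.2.1 l.2.2 x = 0 := by
    rw [Set.mem_ofPred_eq, he, apply_rep_eq_zero_iff, apply_pointVec h2 hω b ψ hl0 hl1 hl2,
      ← elt_zero, hbij.1.eq_iff]
  refine ⟨e, ?_, ?_, ?_⟩
  · rintro _ ⟨ψ, hψ, rfl⟩
    obtain ⟨c0, hc0⟩ := hbij.2 (ψ (b 0))
    obtain ⟨c1, hc1⟩ := hbij.2 (ψ (b 1))
    obtain ⟨c2, hc2⟩ := hbij.2 (ψ (b 2))
    refine ⟨(c0, c1, c2), ?_, mem_iff ψ hc0.symm hc1.symm hc2.symm⟩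
    intro hc
    simp only [Prod.mk_eq_zero] at hc
    refine hψ (b.ext fun i => ?_)
    fin_cases i
    · simp [← hc0, hc.1, elt_zero]
    · simp [← hc1, hc.2.1, elt_zero]
    · simp [← hc2, hc.2.2, elt_zero]
  · intro l hl
    have hψ (i : Fin 3) := b.constr_basis F ![elt ω l.1, elt ω l.2.1, elt ω l.2.2] i
    refine ⟨_, ⟨b.constr F ![elt ω l.1, elt ω l.2.1, elt ω l.2.2], ?_, rfl⟩,
      mem_iff _ (hψ 0) (hψ 1) (hψ 2)⟩
    intro hzero
    simp only [hzero, LinearMap.zero_apply, ← elt_zero] at hψ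
    exact hl (Prod.ext (hbij.1 (hψ 0)).symm
      (Prod.ext (hbij.1 (hψ 1)).symm (hbij.1 (hψ 2)).symm))
  · have he20 : e 20 = P := by
      rw [he, ← P.mk_rep]
      congr 1
      simp [pointVec, Fin.sum_univ_three, coords, elt, hb2]
    refine Finset.eq_of_subset_of_card_le (fun Q hQ => ?_)
      (by rw [Finset.card_map, hcard]; decide)
    obtain ⟨x, rfl⟩ := e.surjective Q
    have hx : φ (e x).rep = 0 := hT hQ
    rw [he, apply_rep_eq_zero_iff, hline b hb0 hb1 (hb2 ▸ hP)] at hx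
    have hx20 : x ≠ 20 := fun h => hPT (he20 ▸ h ▸ hQ)
    refine Finset.mem_map_of_mem _ ?_
    clear hQ
    decide +revert

/-! ### The code in coordinates -/

theorem inCode_add {w w' : Fin 21 → ZMod 2} (hw : InCode w) (hw' : InCode w') :
    InCode (w + w') := fun x => by
  rw [Pi.add_apply, hw x, hw' x, ← Finset.sum_add_distrib]
  refine Finset.sum_congr rfl fun k _ => ?_
  split_ifs <;> simp

theorem inCode_smul (a : ZMod 2) {w : Fin 21 → ZMod 2} (hw : InCode w) : InCode (a • w) :=
  fun x => by
    rw [Pi.smul_apply, hw x, Finset.smul_sum]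
    refine Finset.sum_congr rfl fun k _ => ?_
    split_ifs <;> simp

theorem IsLabelling.mem_CF_iff {e : Fin 21 ≃ ℙ²} {T : Finset ℙ²} (he : IsLabelling e T)
    (w : ℙ² → ZMod 2) : w ∈ CF F T ↔ InCode (w ∘ e) := by
  have hker : w ∈ LinearMap.ker (∑ x ∈ T, LinearMap.proj (R := ZMod 2) (φ := fun _ => ZMod 2) x) ↔
      ∑ x ∈ ({0, 1, 2, 3} : Finset (Fin 21)), w (e x) = 0 := by
    rw [LinearMap.mem_ker, LinearMap.sum_apply, he.eq_map, Finset.sum_map]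
    rfl
  rw [CF, Submodule.mem_inf, hker]
  constructor
  · rintro ⟨hw, hsum⟩
    have key : InCode (w ∘ e + (∑ x ∈ ({0, 1, 2, 3} : Finset (Fin 21)), w (e x)) •
        lineWord (0, 0, 1)) := by
      clear hsum hker
      induction hw using Submodule.span_induction with
      | mem w hw =>
        obtain ⟨L, hL, rfl⟩ := hw
        obtain ⟨l, hl, hmem⟩ := he.exists_form L hL
        have : L.indicator (fun _ => (1 : ZMod 2)) ∘ e = lineWord l := by
          classical
          funext x
          simp only [Function.comp_apply, Set.indicator_apply, hmem, lineWord]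
        simp only [← Function.comp_apply (f := L.indicator _) (g := e), this]
        exact inCode_lineWord_add l.1 l.2.1 l.2.2 hl
      | zero => intro x; simp
      | add u v _ _ hu hv =>
        convert inCode_add hu hv using 1
        simp only [Pi.add_apply, Finset.sum_add_distrib]
        funext x
        simp only [Pi.add_apply, Pi.smul_apply, Function.comp_apply, smul_eq_mul]
        ring
      | smul a v _ hv =>
        convert inCode_smul a hv using 1
        simp only [Pi.smul_apply, ← Finset.smul_sum]
        funext x
        simp only [Pi.add_apply, Pi.smul_apply, Function.comp_apply, smul_eq_mul]
        ring
    rwa [hsum, zero_smul, add_zero] at key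
  · intro hw
    have hw_eq (x : Fin 21) :
        w (e x) = ∑ k : Fin 9, w (e (infoPt k)) * bitVal ((col x).testBit k) := by
      refine (hw x).trans (Finset.sum_congr rfl fun k _ => ?_)
      simp [bitVal]
    constructor
    · have hlineWord (l) (hl : l ≠ 0) : lineWord l ∘ e.symm ∈ CDK F := by
        obtain ⟨L, hL, hmem⟩ := he.exists_line l hl
        refine Submodule.subset_span ⟨L, hL, ?_⟩
        classical
        funext P
        obtain ⟨x, rfl⟩ := e.surjective P
        simp only [Function.comp_apply, e.symm_apply_apply, Set.indicator_apply, hmem, lineWord]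
      have hrow (k : Fin 9) :
          (fun P => bitVal ((col (e.symm P)).testBit k)) ∈ CDK F := by
        have : (fun P => bitVal ((col (e.symm P)).testBit k)) =
            ((rowLines k).map fun l => lineWord l ∘ e.symm).sum := by
          funext P
          rw [← sum_rowLines]
          refine Eq.trans ?_ (map_list_sum (Pi.evalAddMonoidHom (fun _ => ZMod 2) P) _).symm
          rw [List.map_map]
          rfl
        rw [this]
        refine list_sum_mem fun v hv => ?_
        obtain ⟨l, hl, rfl⟩ := List.mem_map.1 hv
        exact hlineWord l (rowLines_ne_zero k l hl)
      have : w = ∑ k : Fin 9, w (e (infoPt k)) •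
          fun P => bitVal ((col (e.symm P)).testBit k) := by
        funext P
        obtain ⟨x, rfl⟩ := e.surjective P
        simp [hw_eq x]
      rw [this]
      exact sum_mem fun k _ => Submodule.smul_mem _ _ (hrow k)
    · rw [Finset.sum_congr rfl fun x _ => hw_eq x, Finset.sum_comm]
      refine Finset.sum_eq_zero fun k _ => ?_
      rw [← Finset.mul_sum, sum_row_tetrad, mul_zero]

theorem IsLabelling.mem_autGroup_iff {e : Fin 21 ≃ ℙ²} {T : Finset ℙ²} (he : IsLabelling e T)
    (τ : Perm (Fin 21)) : τ ∈ autGroup ↔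
      Submodule.map (LinearMap.funLeft (ZMod 2) (ZMod 2) ⇑(e.permCongr τ)) (CF F T) = CF F T := by
  have hcomp (w : ℙ² → ZMod 2) : (w ∘ e.permCongr τ) ∘ e = (w ∘ e) ∘ τ := by
    funext x
    simp [Equiv.permCongr_apply]
  have hmap (w : ℙ² → ZMod 2) : LinearMap.funLeft (ZMod 2) (ZMod 2) (e.permCongr τ) w =
      w ∘ e.permCongr τ := rfl
  constructor
  · intro hτ
    have hmem (w : ℙ² → ZMod 2) : w ∘ e.permCongr τ ∈ CF F T ↔ w ∈ CF F T := by
      rw [he.mem_CF_iff, he.mem_CF_iff, hcomp]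
      exact hτ _
    ext w
    rw [Submodule.mem_map]
    constructor
    · rintro ⟨v, hv, rfl⟩
      exact (hmem v).2 hv
    · intro hw
      have hw' : (w ∘ (e.permCongr τ).symm) ∘ e.permCongr τ = w := by
        rw [Function.comp_assoc, Equiv.symm_comp_self, Function.comp_id]
      exact ⟨w ∘ (e.permCongr τ).symm, (hmem _).1 (hw'.symm ▸ hw), hw'⟩
  · intro h v
    obtain ⟨w, rfl⟩ : ∃ w : ℙ² → ZMod 2, w ∘ e = v :=
      ⟨v ∘ e.symm, by rw [Function.comp_assoc, Equiv.symm_comp_self, Function.comp_id]⟩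
    rw [← hcomp, ← he.mem_CF_iff, ← he.mem_CF_iff, ← hmap]
    conv_lhs => rw [← h]
    rw [Submodule.mem_map]
    exact (LinearMap.funLeft_injective_of_surjective _ _ _
      (e.permCongr τ).surjective).mem_set_image

end Coordinates

end TetradCode

/-- for a four-point subset `F ⊆ P²(F₄)` consisting of four collinear points,
the group of permutations of the 21 points of `P²(F₄)` preserving the code `C_F` has
order 23040. -/
theorem aut_code_C (F : Type*) [Field F] [Fintype F] (hF : Fintype.card F = 4)
    (Fs : Finset (Projectivization F (Fin 3 → F))) (hcard : Fs.card = 4)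
    (hconf : CollinSet F ↑Fs) :
    Nat.card {σ : Equiv.Perm (Projectivization F (Fin 3 → F)) |
      Submodule.map (LinearMap.funLeft (ZMod 2) (ZMod 2) ⇑σ) (CF F Fs) = CF F Fs} = 23040 := by
  obtain ⟨e, he⟩ := TetradCode.exists_isLabelling hF hcard hconf
  rw [← TetradCode.card_autGroup]
  exact (Nat.card_congr (e.permCongr.subtypeEquiv he.mem_autGroup_iff)).symm
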